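/- Let n ≥ 2 and let N = {1,…,n} be partitioned into nonempty sets N_1 and N_2 with l = |N_1| ≥ 1. Let X = (X_i)_{i∈N} be a partition of M into pairwise disjoint bundles such that: (a) for each i ∈ N_2, X_i is a singleton and v_i(X_i) ≥ 1/n − (1/(n−1)) ∑_{j∈N_2∖{i}} m_i(X_j); (b) letting M_1 = M ∖ ⋃_{j∈N_2} X_j, for every i ∈ N_1 and every good g ∈ M_1, v_i(g) < 1/n − (1/(n−1)) ∑_{j∈N_2} m_i(X_j); (c) if l = 1 then the unique agent i ∈ N_1 has X_i = M_1, and if l ≥ 2 then (X_i)_{i∈N_1} is a PROPavg allocation of M_1 to N_1, i.e., v_i(X_i) ≥ v_i(M_1)/l − (1/(l−1)) ∑_{j∈N_1∖{i}} m_i(X_j) for every i ∈ N_1. Then X is a PROPavg allocation of M to N. -/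

import Mathlib

open Finset
open scoped Classical

noncomputable section

variable {G : Type*}

/-- Value of a bundle under an additive valuation. -/
def val (v : G → ℝ) (S : Finset G) : ℝ := ∑ g ∈ S, v g

/-- Minimum value of a good in a bundle; `0` for the empty bundle. -/
def minval (v : G → ℝ) (S : Finset G) : ℝ :=
  if h : S.Nonempty then S.inf' h v else 0

/-- `X` is a partition of the goods into `n` pairwise disjoint (possibly empty) bundles. -/
def IsAlloc {n : ℕ} (X : Fin n → Finset G) : Prop :=
  (∀ i j : Fin n, i ≠ j → Disjoint (X i) (X j)) ∧ (∀ g : G, ∃ i : Fin n, g ∈ X i)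

/-- Agent `i` is PROPavg-satisfied by the allocation `X`. -/
def PROPavgSat {n : ℕ} (v : Fin n → G → ℝ) (X : Fin n → Finset G) (i : Fin n) : Prop :=
  val (v i) (X i) + (1 / ((n : ℝ) - 1)) * ∑ k ∈ Finset.univ.erase i, minval (v i) (X k)
    ≥ 1 / (n : ℝ)

theorem minval_nonneg {G : Type*} {v : G → ℝ} (hv : ∀ g, 0 ≤ v g) (S : Finset G) :
    0 ≤ minval v S := by
  unfold minval
  split_ifs with h
  · exact (Finset.le_inf'_iff h v).2 fun g _ => hv g
  · exact le_rfl

theorem val_nonneg {G : Type*} {v : G → ℝ} (hv : ∀ g, 0 ≤ v g) (S : Finset G) :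
    0 ≤ val v S :=
  Finset.sum_nonneg fun g _ => hv g

theorem minval_eq_val_of_card_eq_one {G : Type*} (v : G → ℝ) {S : Finset G}
    (hS : S.card = 1) : minval v S = val v S := by
  obtain ⟨g, rfl⟩ := Finset.card_eq_one.1 hS
  simp [minval, _root_.val]

theorem minval_le_of_forall_le {G : Type*} {v : G → ℝ} {S : Finset G} {b : ℝ} (hb : 0 ≤ b)
    (h : ∀ g ∈ S, v g ≤ b) : minval v S ≤ b := by
  unfold minval
  split_ifs with hS
  · obtain ⟨g, hg⟩ := hS
    exact (Finset.inf'_le v hg).trans (h g hg)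
  · exact hb

/-- The arithmetic behind combining an average guarantee among `l` agents with one among `n`. -/
theorem avg_bound_of_subgroup_bound {n l S T x : ℝ} (hl : 2 ≤ l) (hln : l + 1 ≤ n)
    (hS : 0 ≤ S) (hb : 0 < 1 / n - 1 / (n - 1) * S)
    (hT : T ≤ (l - 1) * (1 / n - 1 / (n - 1) * S))
    (hx : (1 - S) / l - 1 / (l - 1) * T ≤ x) :
    1 / n ≤ x + 1 / (n - 1) * (S + T) := by
  have hn : 0 < n := by linarith
  have hn1 : 0 < n - 1 := by linarith
  have hl0 : 0 < l := by linarith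
  have hl1 : 0 < l - 1 := by linarith
  obtain ⟨b, hbdef⟩ : ∃ b, b = 1 / n - 1 / (n - 1) * S := ⟨_, rfl⟩
  obtain ⟨t, ht⟩ : ∃ t, t = 1 / (l - 1) * T := ⟨_, rfl⟩
  have hTt : T = (l - 1) * t := by rw [ht]; field_simp
  rw [← hbdef] at hb hT
  rw [← ht] at hx
  have htb : t ≤ b := by
    rw [hTt] at hT
    exact le_of_mul_le_mul_left hT hl1
  have hbn : b ≤ 1 / n := by
    have : 0 ≤ 1 / (n - 1) * S := by positivity
    linarith
  have h1S : n * b ≤ 1 - S := by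
    have : 1 - S = 1 / n + (n - 1) * b := by rw [hbdef]; field_simp; ring
    linarith
  have hsq : l * (2 * n - l - 1) ≤ n * (n - 1) := by
    nlinarith [mul_nonneg (show 0 ≤ n - l by linarith) (show 0 ≤ n - l - 1 by linarith)]
  have hkey : b * ((2 * n - l - 1) / (n - 1)) ≤ (1 - S) / l := by
    rw [le_div_iff₀ hl0]
    refine le_trans ?_ h1S
    have : (2 * n - l - 1) / (n - 1) * l ≤ n := by
      rw [div_mul_eq_mul_div, div_le_iff₀ hn1]; linarith
    nlinarith
  have hsplit : (2 * n - l - 1) / (n - 1) = 1 + (n - l) / (n - 1) := by field_simp; ring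
  have hcoef : 1 / (n - 1) * (l - 1) = 1 - (n - l) / (n - 1) := by field_simp; ring
  have hr : 0 ≤ (n - l) / (n - 1) := div_nonneg (by linarith) hn1.le
  have htr := mul_le_mul_of_nonneg_right htb hr
  have hsum : 1 / (n - 1) * (S + T) = 1 / n - b + t * (1 - (n - l) / (n - 1)) := by
    rw [← hcoef, hTt, hbdef]; ring
  rw [hsplit] at hkey
  rw [hsum]
  linarith

/-- correctness of the preprocessing step (Lemma 7). -/
theorem preprocessing_propavg {G : Type*} [Fintype G] [DecidableEq G] (n : ℕ) (hn : 2 ≤ n)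
    (v : Fin n → G → ℝ)
    (hpos : ∀ (i : Fin n) (g : G), 0 ≤ v i g)
    (hnorm : ∀ i : Fin n, val (v i) (Finset.univ : Finset G) = 1)
    (N1 N2 : Finset (Fin n)) (hdisj : Disjoint N1 N2) (hunion : N1 ∪ N2 = Finset.univ)
    (hN1 : N1.Nonempty) (hN2 : N2.Nonempty)
    (X : Fin n → Finset G) (hX : IsAlloc X)
    (M1 : Finset G) (hM1 : M1 = Finset.univ \ N2.biUnion X)
    (ha : ∀ i ∈ N2, (X i).card = 1 ∧
      val (v i) (X i) ≥ 1 / (n : ℝ)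
        - (1 / ((n : ℝ) - 1)) * ∑ j ∈ N2.erase i, minval (v i) (X j))
    (hb : ∀ i ∈ N1, ∀ g ∈ M1,
      v i g < 1 / (n : ℝ) - (1 / ((n : ℝ) - 1)) * ∑ j ∈ N2, minval (v i) (X j))
    (hc1 : N1.card = 1 → ∀ i ∈ N1, X i = M1)
    (hc2 : 2 ≤ N1.card → ∀ i ∈ N1,
      val (v i) (X i) ≥ val (v i) M1 / (N1.card : ℝ)
        - (1 / ((N1.card : ℝ) - 1)) * ∑ j ∈ N1.erase i, minval (v i) (X j)) :
    ∀ i : Fin n, PROPavgSat v X i := by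
  have hn2 : (2 : ℝ) ≤ n := by exact_mod_cast hn
  have hc : 0 < 1 / ((n : ℝ) - 1) := one_div_pos.2 (by linarith)
  have hm : ∀ i j, 0 ≤ minval (v i) (X j) := fun i j => minval_nonneg (hpos i) _
  intro i
  unfold PROPavgSat
  have hi : i ∈ N1 ∪ N2 := hunion ▸ Finset.mem_univ i
  rcases Finset.mem_union.1 hi with hi1 | hi2
  · have hi2 : i ∉ N2 := Finset.disjoint_left.1 hdisj hi1
    have hsplit : ∑ k ∈ Finset.univ.erase i, minval (v i) (X k)
        = ∑ j ∈ N2, minval (v i) (X j) + ∑ j ∈ N1.erase i, minval (v i) (X j) := by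
      rw [← hunion, Finset.erase_union_distrib, Finset.erase_eq_of_notMem hi2,
        Finset.sum_union (hdisj.mono_left (Finset.erase_subset _ _)), add_comm]
    have hval : val (v i) M1 = 1 - ∑ j ∈ N2, minval (v i) (X j) := by
      have h1 := Finset.sum_sdiff (f := v i) (Finset.subset_univ (N2.biUnion X))
      rw [← hM1, Finset.sum_biUnion fun j _ k _ hjk => hX.1 j k hjk] at h1
      have h2 : ∑ j ∈ N2, minval (v i) (X j) = ∑ j ∈ N2, ∑ g ∈ X j, v i g :=
        Finset.sum_congr rfl fun j hj => minval_eq_val_of_card_eq_one _ (ha j hj).1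
      have h3 := hnorm i
      unfold _root_.val at h3 ⊢
      linarith
    have hM1pos := val_nonneg (hpos i) M1
    have hXpos := val_nonneg (hpos i) (X i)
    have hbi := hb i hi1
    have hS : 0 ≤ ∑ j ∈ N2, minval (v i) (X j) := Finset.sum_nonneg fun j _ => hm i j
    have hT : 0 ≤ ∑ j ∈ N1.erase i, minval (v i) (X j) := Finset.sum_nonneg fun j _ => hm i j
    rw [hsplit]
    rcases le_or_gt (1 / (n : ℝ) - 1 / ((n : ℝ) - 1) * ∑ j ∈ N2, minval (v i) (X j)) 0
      with hb0 | hb0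
    · have := mul_nonneg hc.le hT
      rw [mul_add]
      linarith
    rcases (Nat.succ_le_of_lt hN1.card_pos).eq_or_lt with hl | hl
    · rw [hc1 hl.symm i hi1, hval]
      have hc1' : 1 / ((n : ℝ) - 1) ≤ 1 := by
        rw [div_le_one (by linarith)]; linarith
      have hcn : 1 / (n : ℝ) ≤ 1 / ((n : ℝ) - 1) :=
        one_div_le_one_div_of_le (by linarith) (by linarith)
      have := mul_nonneg hc.le hT
      nlinarith
    · have hcard : N1.card + N2.card = n := by
        rw [← Finset.card_union_of_disjoint hdisj, hunion, Finset.card_univ, Fintype.card_fin]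
      have hN2pos := hN2.card_pos
      refine avg_bound_of_subgroup_bound (l := N1.card) (by exact_mod_cast hl)
        (by exact_mod_cast (by omega : N1.card + 1 ≤ n)) hS hb0 ?_ (hval ▸ hc2 hl i hi1)
      have hle : ∀ j ∈ N1.erase i, minval (v i) (X j)
          ≤ 1 / (n : ℝ) - 1 / ((n : ℝ) - 1) * ∑ j ∈ N2, minval (v i) (X j) := by
        intro j hj
        refine minval_le_of_forall_le hb0.le fun g hg => (hbi g ?_).le
        rw [hM1, Finset.mem_sdiff, Finset.mem_biUnion]
        refine ⟨Finset.mem_univ g, ?_⟩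
        rintro ⟨k, hk, hgk⟩
        have hjk : j ≠ k := fun h =>
          Finset.disjoint_left.1 hdisj (Finset.mem_of_mem_erase hj) (h ▸ hk)
        exact Finset.disjoint_left.1 (hX.1 j k hjk) hg hgk
      have hsum := Finset.sum_le_card_nsmul _ _ _ hle
      rwa [nsmul_eq_mul, Finset.card_erase_of_mem hi1, Nat.cast_pred hN1.card_pos] at hsum
  · have hle : ∑ j ∈ N2.erase i, minval (v i) (X j)
        ≤ ∑ k ∈ Finset.univ.erase i, minval (v i) (X k) :=
      Finset.sum_le_sum_of_subset_of_nonneg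
        (Finset.erase_subset_erase _ (Finset.subset_univ _)) fun j _ _ => hm i j
    have := mul_le_mul_of_nonneg_left hle hc.le
    linarith [(ha i hi2).2]
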